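/- For every totally positive ν ∈ O_K, r_{2,K}(ν) = 2·( 6·σ_{0,χ}(ν) + (ρ₂(ν) − 5)·σ^{𝟙}_{0,χ}(ν) − 4·σ^{𝟙}_{0,χ}(ν/2) ), where the last term σ^{𝟙}_{0,χ}(ν/2) is understood to be 0 when 2 ∤ ν. -/

import Mathlib

/-!
Statements about sums of squares in K = ℚ(√3), with ring of integers O_K = ℤ[√3],
realized as `Zsqrtd 3`.
-/

noncomputable section

namespace Paper3

/-- π₂ = 1 + √3 in ℤ[√3]. -/
def pi2 : Zsqrtd 3 := ⟨1, 1⟩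

/-- The real embedding of ℤ[√3] sending √3 to √3. -/
def emb (x : Zsqrtd 3) : ℝ := (x.re : ℝ) + (x.im : ℝ) * Real.sqrt 3

/-- The real embedding of ℤ[√3] sending √3 to −√3. -/
def embConj (x : Zsqrtd 3) : ℝ := (x.re : ℝ) - (x.im : ℝ) * Real.sqrt 3

/-- An element of ℤ[√3] is totally positive if its images under both real embeddings
are positive. -/
def TotPos (x : Zsqrtd 3) : Prop := 0 < emb x ∧ 0 < embConj x

/-- `r2 ν` is the number of pairs (x₁,x₂) ∈ O_K² with x₁² + x₂² = ν. -/
def r2 (ν : Zsqrtd 3) : ℕ :=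
  Set.ncard {t : Zsqrtd 3 × Zsqrtd 3 | t.1 ^ 2 + t.2 ^ 2 = ν}

/-- The prime ideal 𝔭₂ = (π₂) of O_K, with (2) = 𝔭₂². -/
def p2 : Ideal (Zsqrtd 3) := Ideal.span {pi2}

open Classical in
/-- χ(𝔞) = sgn(N_{K/ℚ}(μ)) for a generator μ of a nonzero ideal 𝔞 coprime to 𝔭₂,
and χ(𝔞) = 0 for 𝔞 not coprime to 𝔭₂ (well defined since every unit has norm 1). -/
def chiIdeal (I : Ideal (Zsqrtd 3)) : ℤ :=
  if h : ∃ μ : Zsqrtd 3, I = Ideal.span {μ} then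
    if I ⊔ p2 = ⊤ then Int.sign (Zsqrtd.norm h.choose) else 0
  else 0

/-- σ_{0,χ}(ν) = Σ_{𝔞 ∣ (ν)} χ(𝔞), the sum over all nonzero ideals 𝔞 dividing (ν). -/
def sigmaChi (ν : Zsqrtd 3) : ℤ :=
  ∑ᶠ I ∈ {I : Ideal (Zsqrtd 3) | I ∣ Ideal.span {ν}}, chiIdeal I

/-- σ^{𝟙}_{0,χ}(ν) = Σ χ(𝔞) over all nonzero ideals 𝔞 dividing (ν) such that (ν)𝔞⁻¹ is
coprime to 𝔭₂; equivalently the sum of χ(𝔞) over all factorizations (ν) = 𝔞·𝔟 with 𝔟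
coprime to 𝔭₂. -/
def sigmaChi1 (ν : Zsqrtd 3) : ℤ :=
  ∑ᶠ p ∈ {p : Ideal (Zsqrtd 3) × Ideal (Zsqrtd 3) |
      p.1 * p.2 = Ideal.span {ν} ∧ p.2 ⊔ p2 = ⊤}, chiIdeal p.1

open Classical in
/-- ρ₂(a + b√3) = (−1)^b if π₂ ∤ ν, and ρ₂(ν) = 0 if π₂ ∣ ν. -/
def rho2 (ν : Zsqrtd 3) : ℤ :=
  if pi2 ∣ ν then 0 else if Even ν.im then 1 else -1


/-- A domain with a multiplicative-style Euclidean size function is a principal ideal ring. -/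
theorem isPrincipalIdealRing_of_size {A : Type*} [CommRing A] (f : A → ℕ)
    (hf : ∀ a b : A, b ≠ 0 → ∃ q, a - b * q = 0 ∨ f (a - b * q) < f b) :
    IsPrincipalIdealRing A := by
  refine ⟨fun I => ?_⟩
  by_cases hI : ∃ b ∈ I, b ≠ 0
  · have hS : {n : ℕ | ∃ b ∈ I, b ≠ 0 ∧ f b = n}.Nonempty := by
      obtain ⟨b, hb, hb0⟩ := hI
      exact ⟨f b, b, hb, hb0, rfl⟩
    obtain ⟨b, hb, hb0, hfb⟩ := Nat.sInf_mem hS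
    refine ⟨b, le_antisymm (fun a ha => ?_) ?_⟩
    · obtain ⟨q, hq⟩ := hf a b hb0
      have hmem : a - b * q ∈ I := I.sub_mem ha (I.mul_mem_right q hb)
      have h0 : a - b * q = 0 := by
        by_contra hne
        have hlt := hq.resolve_left hne
        have hle := Nat.sInf_le (show f (a - b * q) ∈ {n : ℕ | ∃ b ∈ I, b ≠ 0 ∧ f b = n} from
          ⟨_, hmem, hne, rfl⟩)
        omega
      rw [sub_eq_zero] at h0
      exact Ideal.mem_span_singleton.2 ⟨q, h0⟩
    · exact (Ideal.span_singleton_le_iff_mem I).2 hb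
  · push Not at hI
    exact ⟨0, le_antisymm (fun a ha => by simp [hI a ha]) (by simp)⟩

/-- The ring `ℤ[√3]`. -/
local notation "R" => Zsqrtd 3

theorem norm_eq_zero_iff (a : R) : a.norm = 0 ↔ a = 0 := by
  refine Zsqrtd.norm_eq_zero (fun n hn => ?_) a
  have h1 : n ≤ 1 := by nlinarith
  have h2 : -1 ≤ n := by nlinarith
  interval_cases n <;> omega

instance : IsDomain R := by
  have : NoZeroDivisors R := ⟨fun {a b} h => by
    have h' := congrArg Zsqrtd.norm h
    rw [Zsqrtd.norm_mul, Zsqrtd.norm_zero, mul_eq_zero, norm_eq_zero_iff, norm_eq_zero_iff] at h'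
    exact h'⟩
  exact NoZeroDivisors.to_isDomain _

theorem norm_ne_neg_one (a : R) : a.norm ≠ -1 := by
  intro h
  rw [Zsqrtd.norm_def] at h
  have h3 : (a.re * a.re) % 3 = 2 := by
    rw [mul_assoc] at h
    omega
  rcases (by omega : a.re % 3 = 0 ∨ a.re % 3 = 1 ∨ a.re % 3 = 2) with h' | h' | h' <;>
    simp [Int.mul_emod, h'] at h3

theorem isUnit_iff_norm (a : R) : IsUnit a ↔ a.norm = 1 := by
  rw [← Zsqrtd.norm_eq_one_iff]
  have := norm_ne_neg_one a
  omega

/-- Nearest-integer division. -/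
theorem exists_round (a n : ℤ) (hn : 0 < n) : ∃ q : ℤ, 2 * |a - n * q| ≤ n := by
  refine ⟨(2 * a + n) / (2 * n), ?_⟩
  have h1 := Int.emod_add_mul_ediv (2 * a + n) (2 * n)
  have h2 := Int.emod_nonneg (2 * a + n) (by omega : 2 * n ≠ 0)
  have h3 := Int.emod_lt_of_pos (2 * a + n) (by omega : 0 < 2 * n)
  have : 2 * |a - n * ((2 * a + n) / (2 * n))| = |2 * (a - n * ((2 * a + n) / (2 * n)))| := by
    rw [abs_mul]; simp
  rw [this, abs_le]
  constructor <;> nlinarith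

instance : IsPrincipalIdealRing R := by
  refine isPrincipalIdealRing_of_size (fun a => a.norm.natAbs) fun a b hb => ?_
  have hN : b.norm ≠ 0 := fun h => hb ((norm_eq_zero_iff b).1 h)
  have hpos : 0 < |b.norm| := abs_pos.2 hN
  set c := a * star b * (b.norm.sign : R) with hc
  have hbb : b * star b * (b.norm.sign : R) = (|b.norm| : ℤ) := by
    rw [← Zsqrtd.norm_eq_mul_conj, ← Int.cast_mul, mul_comm, Int.sign_mul_self_eq_abs]
  obtain ⟨q1, h1⟩ := exists_round c.re |b.norm| hpos
  obtain ⟨q2, h2⟩ := exists_round c.im |b.norm| hpos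
  refine ⟨⟨q1, q2⟩, Or.inr ?_⟩
  set r : R := a - b * ⟨q1, q2⟩ with hr
  have hrc : r * (star b * (b.norm.sign : R)) = c - (|b.norm| : ℤ) * ⟨q1, q2⟩ := by
    rw [← hbb, hr, hc]; ring
  have hn := congrArg Zsqrtd.norm hrc
  rw [Zsqrtd.norm_mul, Zsqrtd.norm_mul, Zsqrtd.norm_conj, Zsqrtd.norm_intCast,
    Zsqrtd.norm_def (c - _)] at hn
  simp only [Zsqrtd.re_sub, Zsqrtd.im_sub, Zsqrtd.re_mul, Zsqrtd.im_mul, Zsqrtd.re_intCast,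
    Zsqrtd.im_intCast, mul_zero, zero_mul, add_zero] at hn
  have hs : b.norm.sign * b.norm.sign = 1 := by
    rcases lt_or_gt_of_ne hN with h | h
    · simp [Int.sign_eq_neg_one_of_neg h]
    · simp [Int.sign_eq_one_of_pos h]
  rw [hs, mul_one] at hn
  set n := |b.norm| with hnn
  set u := c.re - n * q1
  set v := c.im - n * q2
  have hu : 4 * (u * u) ≤ n * n := by
    have := mul_self_le_mul_self (by positivity) h1
    rw [← abs_mul_abs_self u]; linarith
  have hv : 4 * (v * v) ≤ n * n := by
    have := mul_self_le_mul_self (by positivity) h2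
    rw [← abs_mul_abs_self v]; linarith
  have habs : |r.norm| * n < n * n := by
    rw [hnn, ← abs_mul, hn, abs_lt, ← hnn]
    constructor <;> nlinarith [mul_self_nonneg u, mul_self_nonneg v, mul_pos hpos hpos]
  have := lt_of_mul_lt_mul_right habs hpos.le
  zify
  exact this

theorem prime_pi2 : Prime pi2 := by
  rw [← irreducible_iff_prime]
  have hN : pi2.norm = -2 := by decide
  refine ⟨fun h => ?_, fun {a b} h => ?_⟩
  · rw [isUnit_iff_norm] at h; omega
  · have h' := congrArg (fun x => (Zsqrtd.norm x).natAbs) h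
    simp only [hN, Zsqrtd.norm_mul, Int.natAbs_mul] at h'
    rw [← Zsqrtd.norm_eq_one_iff, ← Zsqrtd.norm_eq_one_iff]
    rcases (Nat.dvd_prime Nat.prime_two).1 (Dvd.intro _ h'.symm) with h | h
    · exact Or.inl h
    · right; rw [h] at h'; simp at h'; omega

theorem pi2_dvd_iff (a : R) : pi2 ∣ a ↔ (a.re + a.im) % 2 = 0 := by
  constructor
  · rintro ⟨c, rfl⟩
    simp only [Zsqrtd.re_mul, Zsqrtd.im_mul, pi2]
    omega
  · intro h
    refine ⟨⟨(3 * a.im - a.re) / 2, (a.re - a.im) / 2⟩, ?_⟩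
    ext <;> simp only [Zsqrtd.re_mul, Zsqrtd.im_mul, pi2] <;> omega

theorem two_dvd_iff (a : R) : 2 ∣ a ↔ a.re % 2 = 0 ∧ a.im % 2 = 0 := by
  have := Zsqrtd.intCast_dvd (d := 3) 2 a
  rw [Int.dvd_iff_emod_eq_zero, Int.dvd_iff_emod_eq_zero] at this
  exact_mod_cast this

theorem span_sup_p2 (μ : R) : Ideal.span {μ} ⊔ p2 = ⊤ ↔ ¬ pi2 ∣ μ := by
  rw [p2, ← Ideal.isCoprime_iff_sup_eq, Ideal.isCoprime_span_singleton_iff, isCoprime_comm]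
  exact prime_pi2.irreducible.coprime_iff_not_dvd

open Classical in
theorem chiIdeal_span (μ : R) :
    chiIdeal (Ideal.span {μ}) = if pi2 ∣ μ then 0 else μ.norm.sign := by
  have h : ∃ μ' : R, Ideal.span {μ} = Ideal.span {μ'} := ⟨μ, rfl⟩
  rw [chiIdeal, dif_pos h]
  have hn : h.choose.norm = μ.norm := by
    obtain ⟨u, hu⟩ := Ideal.span_singleton_eq_span_singleton.1 h.choose_spec
    rw [← hu, Zsqrtd.norm_mul, (isUnit_iff_norm _).1 u.isUnit, mul_one]
  simp only [span_sup_p2, hn]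
  split_ifs <;> rfl

theorem exists_span (I : Ideal R) : ∃ μ : R, I = Ideal.span {μ} :=
  (IsPrincipalIdealRing.principal I).principal

theorem chiIdeal_mul (I J : Ideal R) : chiIdeal (I * J) = chiIdeal I * chiIdeal J := by
  obtain ⟨a, rfl⟩ := exists_span I
  obtain ⟨b, rfl⟩ := exists_span J
  rw [Ideal.span_singleton_mul_span_singleton]
  have hd : pi2 ∣ a * b ↔ pi2 ∣ a ∨ pi2 ∣ b := prime_pi2.dvd_mul
  simp only [chiIdeal_span, Zsqrtd.norm_mul, Int.sign_mul]
  by_cases ha : pi2 ∣ a <;> by_cases hb : pi2 ∣ b <;> simp [ha, hb, hd]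

/-- The set of ideals dividing `(ν)`. -/
def divs (ν : R) : Set (Ideal R) := {I | I ∣ Ideal.span {ν}}

theorem span_ne_zero {ν : R} (h : ν ≠ 0) : (Ideal.span {ν} : Ideal R) ≠ 0 := by
  simpa using h

theorem finite_divs {ν : R} (h : ν ≠ 0) : (divs ν).Finite :=
  have : Finite {I : Ideal R // I ∣ Ideal.span {ν}} :=
    @Finite.of_fintype _ (UniqueFactorizationMonoid.fintypeSubtypeDvd _ (span_ne_zero h))
  this

theorem sigmaChi_def (ν : R) : sigmaChi ν = ∑ᶠ I ∈ divs ν, chiIdeal I := rfl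

theorem mem_divs_mul (p : R) (hp : Prime p) (ν : R) (I : Ideal R) :
    I ∈ divs (p * ν) ↔ I ∈ divs ν ∨ ∃ J ∈ divs ν, Ideal.span {p} * J = I := by
  obtain ⟨a, rfl⟩ := exists_span I
  simp only [divs, Set.mem_ofPred_eq]
  constructor
  · intro h
    rw [Ideal.span_singleton_dvd_span_singleton_iff_dvd] at h
    by_cases hpa : p ∣ a
    · obtain ⟨b, rfl⟩ := hpa
      right
      refine ⟨Ideal.span {b}, ?_, Ideal.span_singleton_mul_span_singleton _ _⟩
      rw [Ideal.span_singleton_dvd_span_singleton_iff_dvd]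
      exact (mul_dvd_mul_iff_left hp.ne_zero).1 h
    · left
      rw [Ideal.span_singleton_dvd_span_singleton_iff_dvd]
      exact ((hp.irreducible.coprime_iff_not_dvd.2 hpa).symm).dvd_of_dvd_mul_left h
  · rw [← Ideal.span_singleton_mul_span_singleton]
    rintro (h | ⟨J, hJ, h⟩)
    · exact h.mul_left _
    · rw [← h]; exact mul_dvd_mul_left _ hJ

theorem divs_mul {p : R} (hp : Prime p) (ν : R) :
    divs (p * ν) = divs ν ∪ (Ideal.span {p} * ·) '' divs ν := by
  ext I
  rw [mem_divs_mul p hp ν I]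
  simp

theorem divs_inter_of_dvd {p : R} (hp : Prime p) (ν : R) :
    divs (p * ν) ∩ (Ideal.span {p} * ·) '' divs (p * ν) = (Ideal.span {p} * ·) '' divs ν := by
  have h0 := span_ne_zero hp.ne_zero
  ext I
  constructor
  · rintro ⟨h1, J, hJ, rfl⟩
    refine ⟨J, ?_, rfl⟩
    simp only [divs, Set.mem_ofPred_eq, ← Ideal.span_singleton_mul_span_singleton] at h1
    exact (mul_dvd_mul_iff_left h0).1 h1
  · rintro ⟨J, hJ, rfl⟩
    have hJ' : J ∣ Ideal.span {ν} := hJ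
    simp only [divs, Set.mem_inter_iff, Set.mem_ofPred_eq,
      ← Ideal.span_singleton_mul_span_singleton]
    exact ⟨mul_dvd_mul_left _ hJ', J, hJ'.mul_left _, rfl⟩

theorem divs_inter_of_not_dvd {p ν : R} (h : ¬ p ∣ ν) :
    divs ν ∩ (Ideal.span {p} * ·) '' divs ν = ∅ := by
  rw [Set.eq_empty_iff_forall_notMem]
  rintro _ ⟨h1, J, hJ, rfl⟩
  exact h (Ideal.span_singleton_dvd_span_singleton_iff_dvd.1 ((Dvd.intro _ rfl).trans h1))

theorem finsum_image_mul {p : R} (hp : Prime p) (ν : R) :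
    ∑ᶠ I ∈ (Ideal.span {p} * ·) '' divs ν, chiIdeal I = chiIdeal (Ideal.span {p}) * sigmaChi ν := by
  have h0 := span_ne_zero hp.ne_zero
  rw [finsum_mem_image fun _ _ _ _ h => mul_left_cancel₀ h0 h, sigmaChi_def]
  simp only [chiIdeal_mul]
  exact (mul_finsum_mem _ _).symm

theorem sigmaChi_mul_of_not_dvd {p : R} (hp : Prime p) {ν : R} (hν : ν ≠ 0) (h : ¬ p ∣ ν) :
    sigmaChi (p * ν) = (1 + chiIdeal (Ideal.span {p})) * sigmaChi ν := by
  have hf := finite_divs hν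
  have := finsum_mem_union_inter (f := chiIdeal) hf (hf.image (Ideal.span {p} * ·))
  rw [← divs_mul hp, divs_inter_of_not_dvd h, finsum_mem_empty, finsum_image_mul hp,
    ← sigmaChi_def, ← sigmaChi_def] at this
  linarith

theorem sigmaChi_mul_mul {p : R} (hp : Prime p) {ν : R} (hν : ν ≠ 0) :
    sigmaChi (p * (p * ν)) = (1 + chiIdeal (Ideal.span {p})) * sigmaChi (p * ν)
      - chiIdeal (Ideal.span {p}) * sigmaChi ν := by
  have hf := finite_divs (mul_ne_zero hp.ne_zero hν)
  have := finsum_mem_union_inter (f := chiIdeal) hf (hf.image (Ideal.span {p} * ·))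
  rw [← divs_mul hp, divs_inter_of_dvd hp, finsum_image_mul hp, finsum_image_mul hp,
    ← sigmaChi_def, ← sigmaChi_def] at this
  linarith

theorem sigmaChi_unit {u : R} (hu : IsUnit u) : sigmaChi u = 1 := by
  have : divs u = {⊤} := by
    ext I
    simp only [divs, Ideal.span_singleton_eq_top.2 hu, Set.mem_ofPred_eq, Set.mem_singleton_iff]
    rw [← Ideal.one_eq_top, ← isUnit_iff_dvd_one, Ideal.isUnit_iff, Ideal.one_eq_top]
  rw [sigmaChi_def, this, finsum_mem_singleton, ← Ideal.span_singleton_one, chiIdeal_span,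
    if_neg (fun h => prime_pi2.not_isUnit (isUnit_of_dvd_one h))]
  simp

theorem sigmaChi_pi2_mul {ν : R} (hν : ν ≠ 0) : sigmaChi (pi2 * ν) = sigmaChi ν := by
  have h0 : chiIdeal (Ideal.span {pi2}) = 0 := by rw [chiIdeal_span, if_pos dvd_rfl]
  by_cases h : pi2 ∣ ν
  · obtain ⟨μ, rfl⟩ := h
    rw [sigmaChi_mul_mul prime_pi2 (right_ne_zero_of_mul hν), h0]; ring
  · rw [sigmaChi_mul_of_not_dvd prime_pi2 hν h, h0]; ring

theorem sigmaChi1_of_not_dvd {ν : R} (h : ¬ pi2 ∣ ν) : sigmaChi1 ν = sigmaChi ν := by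
  have hν : ν ≠ 0 := fun h0 => h (h0 ▸ dvd_zero _)
  refine finsum_mem_eq_of_bijOn Prod.fst ⟨?_, ?_, ?_⟩ fun _ _ => rfl
  · rintro ⟨I, J⟩ ⟨h1, -⟩
    exact Dvd.intro _ h1
  · rintro ⟨I, J⟩ ⟨h1, -⟩ ⟨I', J'⟩ ⟨h2, -⟩ (rfl : I = I')
    have hI : I ≠ 0 := by
      rintro rfl
      exact span_ne_zero hν (by rw [← h1]; simp)
    have : J = J' := mul_left_cancel₀ hI (h1.trans h2.symm)
    rw [this]
  · rintro I ⟨J, hJ⟩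
    refine ⟨(I, J), ⟨hJ.symm, ?_⟩, rfl⟩
    obtain ⟨b, rfl⟩ := exists_span J
    rw [span_sup_p2]
    exact fun hb => h (hb.trans
      (Ideal.span_singleton_dvd_span_singleton_iff_dvd.1 (hJ ▸ Dvd.intro_left _ rfl)))

theorem sigmaChi1_of_dvd {ν : R} (h : pi2 ∣ ν) : sigmaChi1 ν = 0 := by
  refine finsum_mem_eq_zero_of_forall_eq_zero ?_
  rintro ⟨I, J⟩ ⟨h1, h2⟩
  obtain ⟨a, rfl⟩ := exists_span I
  obtain ⟨b, rfl⟩ := exists_span J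
  rw [span_sup_p2] at h2
  rw [Ideal.span_singleton_mul_span_singleton, Ideal.span_singleton_eq_span_singleton] at h1
  rw [chiIdeal_span, if_pos]
  exact (prime_pi2.dvd_or_dvd (h.trans h1.dvd')).resolve_right h2

/-- The ring of integers `ℤ[ζ₁₂]` of `ℚ(√3, i)`, with `ω = ζ₁₂` satisfying `ω² = √3 ω - 1`. -/
local notation "S" => QuadraticAlgebra (Zsqrtd 3) (-1) Zsqrtd.sqrtd

theorem norm_re (α : S) : α.norm.re =
    (α.re.re ^ 2 + 3 * α.re.re * α.im.im + 3 * α.im.im ^ 2) +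
      (α.im.re ^ 2 + 3 * α.im.re * α.re.im + 3 * α.re.im ^ 2) := by
  simp [QuadraticAlgebra.norm_def]
  ring

theorem norm_im (α : S) : α.norm.im = 2 * α.re.re * α.re.im + 2 * α.im.re * α.im.im +
      α.re.re * α.im.re + 3 * α.re.im * α.im.im := by
  simp [QuadraticAlgebra.norm_def]
  ring

theorem norm_re_bound (α : S) : α.re.re ^ 2 ≤ 4 * α.norm.re ∧ α.re.im ^ 2 ≤ 4 * α.norm.re ∧
    α.im.re ^ 2 ≤ 4 * α.norm.re ∧ α.im.im ^ 2 ≤ 4 * α.norm.re := by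
  rw [norm_re]
  refine ⟨?_, ?_, ?_, ?_⟩ <;>
  nlinarith [sq_nonneg (2 * α.re.re + 3 * α.im.im), sq_nonneg (α.re.re + 2 * α.im.im),
    sq_nonneg (2 * α.im.re + 3 * α.re.im), sq_nonneg (α.im.re + 2 * α.re.im),
    sq_nonneg α.re.re, sq_nonneg α.re.im, sq_nonneg α.im.re, sq_nonneg α.im.im]

theorem algNorm_eq_zero {α : S} (h : α.norm = 0) : α = 0 := by
  obtain ⟨h1, h2, h3, h4⟩ := norm_re_bound α
  rw [h] at h1 h2 h3 h4
  simp only [Zsqrtd.re_zero, mul_zero, sq_nonpos_iff] at h1 h2 h3 h4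
  ext <;> simp [h1, h2, h3, h4]

instance : IsDomain S := by
  have : NoZeroDivisors S := ⟨fun {a b} h => by
    have h' := congrArg QuadraticAlgebra.norm h
    rw [map_mul, QuadraticAlgebra.norm_zero, mul_eq_zero] at h'
    exact h'.imp algNorm_eq_zero algNorm_eq_zero⟩
  exact NoZeroDivisors.to_isDomain _

theorem emb_mul (a b : R) : emb (a * b) = emb a * emb b := by
  have h : Real.sqrt 3 * Real.sqrt 3 = 3 := Real.mul_self_sqrt (by norm_num)
  simp only [emb, Zsqrtd.re_mul, Zsqrtd.im_mul]
  push_cast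
  linear_combination -(a.im * b.im : ℝ) * h

theorem embConj_mul (a b : R) : embConj (a * b) = embConj a * embConj b := by
  have h : Real.sqrt 3 * Real.sqrt 3 = 3 := Real.mul_self_sqrt (by norm_num)
  simp only [embConj, Zsqrtd.re_mul, Zsqrtd.im_mul]
  push_cast
  linear_combination -(a.im * b.im : ℝ) * h

theorem emb_mul_embConj (a : R) : emb a * embConj a = a.norm := by
  have h : Real.sqrt 3 * Real.sqrt 3 = 3 := Real.mul_self_sqrt (by norm_num)
  simp only [emb, embConj, Zsqrtd.norm_def]
  push_cast
  linear_combination -(a.im * a.im : ℝ) * h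

theorem TotPos.norm_pos {a : R} (h : TotPos a) : 0 < a.norm := by
  have := mul_pos h.1 h.2
  rw [emb_mul_embConj] at this
  exact_mod_cast this

theorem TotPos.re_pos {a : R} (h : TotPos a) : 0 < a.re := by
  have := add_pos h.1 h.2
  simp only [emb, embConj] at this
  have h2 : (0 : ℝ) < a.re := by linarith
  exact_mod_cast h2

theorem TotPos.ne_zero {a : R} (h : TotPos a) : a ≠ 0 := by
  rintro rfl
  simpa using h.norm_pos

theorem TotPos.of_mul {a b : R} (h : TotPos (a * b)) (ha : TotPos a) : TotPos b := by
  rw [TotPos, emb_mul, embConj_mul] at h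
  exact ⟨(pos_iff_pos_of_mul_pos h.1).1 ha.1, (pos_iff_pos_of_mul_pos h.2).1 ha.2⟩

theorem TotPos.mul_self {a : R} (h : a ≠ 0) : TotPos (a * a) := by
  have h1 : emb a * embConj a ≠ 0 := by
    rw [emb_mul_embConj, Int.cast_ne_zero, Ne, norm_eq_zero_iff]
    exact h
  rw [TotPos, emb_mul, embConj_mul]
  exact ⟨mul_self_pos.2 (left_ne_zero_of_mul h1), mul_self_pos.2 (right_ne_zero_of_mul h1)⟩

theorem totPos_norm {α : S} (h : α ≠ 0) : TotPos α.norm := by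
  have h0 : α.norm ≠ 0 := fun h' => h (algNorm_eq_zero h')
  have h1 : emb α.norm * embConj α.norm ≠ 0 := by
    rw [emb_mul_embConj, Int.cast_ne_zero, Ne, norm_eq_zero_iff]
    exact h0
  have h3 : Real.sqrt 3 * Real.sqrt 3 = 3 := Real.mul_self_sqrt (by norm_num)
  have key : ∀ X Y : ℝ, 0 ≤ X ^ 2 + Real.sqrt 3 * X * Y + Y ^ 2 ∧
      0 ≤ X ^ 2 - Real.sqrt 3 * X * Y + Y ^ 2 := fun X Y => by
    constructor
    · nlinarith [sq_nonneg (2 * X + Real.sqrt 3 * Y), sq_nonneg Y]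
    · nlinarith [sq_nonneg (2 * X - Real.sqrt 3 * Y), sq_nonneg Y]
  have e1 : emb α.norm = emb α.re ^ 2 + Real.sqrt 3 * emb α.re * emb α.im + emb α.im ^ 2 := by
    simp only [emb, norm_re, norm_im]
    push_cast
    linear_combination (-(α.re.im ^ 2 + α.im.im ^ 2 : ℝ) - α.re.re * α.im.im - α.re.im * α.im.re
      - α.re.im * α.im.im * Real.sqrt 3) * h3
  have e2 : embConj α.norm =
      embConj α.re ^ 2 - Real.sqrt 3 * embConj α.re * embConj α.im + embConj α.im ^ 2 := by
    simp only [embConj, norm_re, norm_im]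
    push_cast
    linear_combination (-(α.re.im ^ 2 + α.im.im ^ 2 : ℝ) - α.re.re * α.im.im - α.re.im * α.im.re
      + α.re.im * α.im.im * Real.sqrt 3) * h3
  refine ⟨lt_of_le_of_ne ?_ (left_ne_zero_of_mul h1).symm,
    lt_of_le_of_ne ?_ (right_ne_zero_of_mul h1).symm⟩
  · rw [e1]; exact (key _ _).1
  · rw [e2]; exact (key _ _).2

theorem exists_round_two (a n : ℤ) (hn : 0 < n) : ∃ q : ℤ, (a - 2 * n * q) ^ 2 ≤ n ^ 2 := by
  obtain ⟨q, hq⟩ := exists_round a (2 * n) (by omega)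
  exact ⟨q, sq_le_sq' (by linarith [neg_abs_le (a - 2 * n * q)])
    (by linarith [le_abs_self (a - 2 * n * q)])⟩

instance : IsPrincipalIdealRing S := by
  refine isPrincipalIdealRing_of_size (fun a => a.norm.norm.natAbs) fun a b hb => ?_
  have hpos : 0 < b.norm.norm := (totPos_norm hb).norm_pos
  set n := b.norm.norm with hn
  set c : S := a * (star b * algebraMap R S (star b.norm)) with hc
  have hbb : b * (star b * algebraMap R S (star b.norm)) = algebraMap R S n := by
    rw [← mul_assoc, ← QuadraticAlgebra.algebraMap_norm_eq_mul_star, ← map_mul,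
      ← Zsqrtd.norm_eq_mul_conj]
  obtain ⟨q4, h4⟩ := exists_round_two (2 * c.im.im) n hpos
  obtain ⟨q1, h1⟩ := exists_round_two (2 * c.re.re + 3 * (c.im.im - n * q4)) n hpos
  obtain ⟨q2, h2⟩ := exists_round_two (2 * c.re.im) n hpos
  obtain ⟨q3, h3⟩ := exists_round_two (2 * c.im.re + 3 * (c.re.im - n * q2)) n hpos
  set q : S := ⟨⟨q1, q2⟩, ⟨q3, q4⟩⟩ with hq
  refine ⟨q, ?_⟩
  by_cases hr0 : a - b * q = 0
  · exact Or.inl hr0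
  right
  set r : S := a - b * q with hr
  set d : S := c - algebraMap R S n * q with hd
  have hrc : r * (star b * algebraMap R S (star b.norm)) = d := by
    rw [hd, ← hbb, hr, hc]; ring
  have hnn := congrArg (fun z : S => z.norm.norm) hrc
  simp only [map_mul, QuadraticAlgebra.norm_star, QuadraticAlgebra.norm_algebraMap,
    Zsqrtd.norm_mul, pow_two, Zsqrtd.norm_conj, ← hn] at hnn
  have hd1 : d.re.re = c.re.re - n * q1 := by simp [hd, hq]
  have hd2 : d.re.im = c.re.im - n * q2 := by simp [hd, hq]
  have hd3 : d.im.re = c.im.re - n * q3 := by simp [hd, hq]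
  have hd4 : d.im.im = c.im.im - n * q4 := by simp [hd, hq]
  rw [← hd4] at h1
  rw [← hd2] at h3
  have hP : 16 * d.norm.re ≤ 14 * n ^ 2 := by
    rw [norm_re]
    have e1 : 2 * c.re.re + 3 * d.im.im - 2 * n * q1 = 2 * d.re.re + 3 * d.im.im := by
      rw [hd1]; ring
    have e3 : 2 * c.im.re + 3 * d.re.im - 2 * n * q3 = 2 * d.im.re + 3 * d.re.im := by
      rw [hd3]; ring
    have e2 : 2 * c.re.im - 2 * n * q2 = 2 * d.re.im := by rw [hd2]; ring
    have e4 : 2 * c.im.im - 2 * n * q4 = 2 * d.im.im := by rw [hd4]; ring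
    rw [e1] at h1
    rw [e2] at h2
    rw [e3] at h3
    rw [e4] at h4
    linarith
  have hP0 : 0 ≤ d.norm.re := by nlinarith [(norm_re_bound d).1, sq_nonneg d.re.re]
  have hlt : d.norm.norm < n ^ 4 := by
    have h5 : d.norm.norm ≤ d.norm.re ^ 2 := by
      rw [Zsqrtd.norm_def]; nlinarith [sq_nonneg d.norm.im]
    have h6 : d.norm.re < n ^ 2 := by nlinarith [sq_pos_of_pos hpos]
    nlinarith
  have hr1 : 0 < r.norm.norm := (totPos_norm hr0).norm_pos
  have h7 : r.norm.norm * n ^ 3 < n * n ^ 3 := by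
    calc r.norm.norm * n ^ 3 = d.norm.norm := by rw [← hnn]; ring
      _ < n ^ 4 := hlt
      _ = n * n ^ 3 := by ring
  have h8 := lt_of_mul_lt_mul_right h7 (by positivity)
  show r.norm.norm.natAbs < n.natAbs
  omega

theorem norm_dvd {α β : S} (h : α ∣ β) : α.norm ∣ β.norm := map_dvd QuadraticAlgebra.norm h

theorem star_dvd_star {α β : S} (h : α ∣ β) : star α ∣ star β := map_dvd (starRingEnd S) h

theorem star_algebraMap (p : R) : star (algebraMap R S p) = algebraMap R S p := by
  ext <;> simp

theorem prime_or_exists_norm {p : R} (hp : Prime p) :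
    Prime (algebraMap R S p) ∨ ∃ ϖ : S, Associated ϖ.norm p := by
  by_contra! hcon
  refine hcon.1 ?_
  rw [← irreducible_iff_prime]
  refine ⟨fun h => ?_, fun {a b} h => ?_⟩
  · rw [QuadraticAlgebra.isUnit_iff_norm_isUnit, QuadraticAlgebra.norm_algebraMap,
      isUnit_pow_iff two_ne_zero] at h
    exact hp.not_isUnit h
  · have h' := congrArg QuadraticAlgebra.norm h
    rw [QuadraticAlgebra.norm_algebraMap, map_mul] at h'
    obtain ⟨i, hi, hai⟩ := (dvd_prime_pow hp 2).1 (Dvd.intro _ h'.symm)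
    rw [QuadraticAlgebra.isUnit_iff_norm_isUnit, QuadraticAlgebra.isUnit_iff_norm_isUnit]
    interval_cases i
    · left; rwa [pow_zero, associated_one_iff_isUnit] at hai
    · exact absurd (by rwa [pow_one] at hai) (hcon.2 a)
    · right
      obtain ⟨u, hu⟩ := hai
      rw [← hu] at h'
      have h0 : a.norm ≠ 0 := by
        rintro h0
        rw [h0, zero_mul] at hu
        exact pow_ne_zero 2 hp.ne_zero hu.symm
      rw [← mul_left_cancel₀ h0 h']
      exact u.isUnit

theorem norm_eq_of_associated {a b : R} (h : Associated a b) : a.norm = b.norm := by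
  obtain ⟨u, rfl⟩ := h
  rw [Zsqrtd.norm_mul, (isUnit_iff_norm _).1 u.isUnit, mul_one]

theorem prime_algebraMap {p : R} (hp : Prime p) (hneg : p.norm < 0) :
    Prime (algebraMap R S p) := by
  refine (prime_or_exists_norm hp).resolve_right ?_
  rintro ⟨ϖ, h⟩
  have h1 := norm_eq_of_associated h
  have h2 : ϖ ≠ 0 := by
    rintro rfl
    rw [QuadraticAlgebra.norm_zero, Zsqrtd.norm_zero] at h1
    omega
  have := (totPos_norm h2).norm_pos
  omega

/-- Elements of `ℤ[ζ₁₂]` of relative norm `ν`. -/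
def fib (ν : R) : Set S := {α | α.norm = ν}

theorem mem_fib {ν : R} {α : S} : α ∈ fib ν ↔ α.norm = ν := Iff.rfl

/-- The element of `ℤ[ζ₁₂]` with given integer coordinates. -/
def ofTuple (t : ℤ × ℤ × ℤ × ℤ) : S := ⟨⟨t.1, t.2.1⟩, ⟨t.2.2.1, t.2.2.2⟩⟩

theorem ofTuple_injective : Function.Injective ofTuple := by
  rintro ⟨a, b, c, d⟩ ⟨a', b', c', d'⟩ h
  simp only [ofTuple, QuadraticAlgebra.mk.injEq, Zsqrtd.mk.injEq] at h
  simp [h]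

/-- Integer coordinates bounded by `M` of elements of relative norm `ν`. -/
def box (M : ℤ) (ν : R) : Finset (ℤ × ℤ × ℤ × ℤ) :=
  (Finset.Icc (-M) M ×ˢ Finset.Icc (-M) M ×ˢ Finset.Icc (-M) M ×ˢ Finset.Icc (-M) M).filter
    fun t => (t.1 ^ 2 + 3 * t.1 * t.2.2.2 + 3 * t.2.2.2 ^ 2) +
      (t.2.2.1 ^ 2 + 3 * t.2.2.1 * t.2.1 + 3 * t.2.1 ^ 2) = ν.re ∧
      2 * t.1 * t.2.1 + 2 * t.2.2.1 * t.2.2.2 + t.1 * t.2.2.1 + 3 * t.2.1 * t.2.2.2 = ν.im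

theorem fib_eq_image {M : ℤ} (hM : 0 ≤ M) {ν : R} (h : 4 * ν.re ≤ M ^ 2) :
    fib ν = ofTuple '' (box M ν : Set (ℤ × ℤ × ℤ × ℤ)) := by
  ext α
  rw [mem_fib]
  constructor
  · rintro rfl
    obtain ⟨h1, h2, h3, h4⟩ := norm_re_bound α
    refine ⟨(α.re.re, α.re.im, α.im.re, α.im.im), ?_, rfl⟩
    simp only [box, Finset.coe_filter, Finset.mem_product, Finset.mem_Icc, Set.mem_ofPred_eq]
    exact ⟨⟨abs_le_of_sq_le_sq' (h1.trans h) hM, abs_le_of_sq_le_sq' (h2.trans h) hM,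
      abs_le_of_sq_le_sq' (h3.trans h) hM, abs_le_of_sq_le_sq' (h4.trans h) hM⟩,
      (norm_re α).symm, (norm_im α).symm⟩
  · rintro ⟨t, ht, rfl⟩
    simp only [box, Finset.coe_filter, Set.mem_ofPred_eq] at ht
    ext
    · rw [norm_re]; exact ht.2.1
    · rw [norm_im]; exact ht.2.2

theorem finite_fib (ν : R) : (fib ν).Finite := by
  rw [fib_eq_image (M := 1 + 4 * |ν.re|) (by positivity)
    (by nlinarith [le_abs_self ν.re, abs_nonneg ν.re])]
  exact (Finset.finite_toSet _).image _

theorem ncard_fib_one : (fib 1).ncard = 12 := by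
  rw [fib_eq_image (M := 2) (by norm_num) (by simp),
    Set.ncard_image_of_injective _ ofTuple_injective, Set.ncard_coe_finset]
  decide +kernel

theorem ncard_mul_image {β : S} (hβ : β ≠ 0) (s : Set S) : ((β * ·) '' s).ncard = s.ncard :=
  Set.ncard_image_of_injective _ (mul_right_injective₀ hβ)

theorem mul_fib_eq {β : S} (hβ : β ≠ 0) (ν : R) :
    (β * ·) '' fib ν = {α ∈ fib (β.norm * ν) | β ∣ α} := by
  have h0 : β.norm ≠ 0 := fun h => hβ (algNorm_eq_zero h)
  ext α
  constructor
  · rintro ⟨γ, hγ, rfl⟩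
    refine ⟨?_, dvd_mul_right _ _⟩
    rw [mem_fib] at hγ ⊢
    rw [map_mul, hγ]
  · rintro ⟨h, γ, rfl⟩
    refine ⟨γ, ?_, rfl⟩
    rw [mem_fib, map_mul] at h
    exact mul_left_cancel₀ h0 h

theorem algebraMap_ne_zero {p : R} (hp : p ≠ 0) : algebraMap R S p ≠ 0 := fun h =>
  hp (QuadraticAlgebra.algebraMap_injective (by rw [h, map_zero]))

theorem algebraMap_dvd_of_mem_fib {p ν : R} (hp : Prime p) (hneg : p.norm < 0) {α : S}
    (h : α ∈ fib (p * ν)) : algebraMap R S p ∣ α := by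
  have hP := prime_algebraMap hp hneg
  have h1 : algebraMap R S p ∣ α * star α := by
    rw [← QuadraticAlgebra.algebraMap_norm_eq_mul_star, mem_fib.1 h, map_mul]
    exact dvd_mul_right _ _
  rcases hP.dvd_or_dvd h1 with h2 | h2
  · exact h2
  · have := star_dvd_star h2
    rwa [star_algebraMap, star_star] at this

theorem fib_of_not_dvd {p ν : R} (hp : Prime p) (hneg : p.norm < 0) (h : ¬ p ∣ ν) :
    fib (p * ν) = ∅ := by
  rw [Set.eq_empty_iff_forall_notMem]
  intro α hα
  obtain ⟨β, rfl⟩ := algebraMap_dvd_of_mem_fib hp hneg hα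
  rw [mem_fib, map_mul, QuadraticAlgebra.norm_algebraMap, pow_two, mul_assoc] at hα
  exact h ⟨_, (mul_left_cancel₀ hp.ne_zero hα).symm⟩

theorem fib_mul_mul {p : R} (hp : Prime p) (hneg : p.norm < 0) (ν : R) :
    fib (p * (p * ν)) = (algebraMap R S p * ·) '' fib ν := by
  rw [mul_fib_eq (algebraMap_ne_zero hp.ne_zero), QuadraticAlgebra.norm_algebraMap, pow_two,
    mul_assoc]
  ext α
  exact ⟨fun h => ⟨h, algebraMap_dvd_of_mem_fib hp hneg h⟩, fun h => h.1⟩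

theorem ncard_fib_mul_mul {p : R} (hp : Prime p) (hneg : p.norm < 0) (ν : R) :
    (fib (p * (p * ν))).ncard = (fib ν).ncard := by
  rw [fib_mul_mul hp hneg, ncard_mul_image (algebraMap_ne_zero hp.ne_zero)]

theorem prime_of_prime_norm {ϖ : S} (h : Prime ϖ.norm) : Prime ϖ := by
  rw [← irreducible_iff_prime]
  refine ⟨fun hu => h.not_isUnit (QuadraticAlgebra.isUnit_iff_norm_isUnit.1 hu),
    fun {a b} hab => ?_⟩
  rw [hab, map_mul] at h
  rw [QuadraticAlgebra.isUnit_iff_norm_isUnit, QuadraticAlgebra.isUnit_iff_norm_isUnit]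
  exact h.irreducible.isUnit_or_isUnit rfl

theorem not_dvd_star {ϖ : S} (h : Prime ϖ.norm) : ¬ ϖ ∣ star ϖ := by
  intro hd
  have h1 := norm_dvd (dvd_sub_self_left.2 hd : ϖ ∣ ϖ - star ϖ)
  have h2 : (ϖ - star ϖ).norm = ϖ.im ^ 2 := by
    have h3 : (Zsqrtd.sqrtd : R) * Zsqrtd.sqrtd = 3 := by decide
    simp only [QuadraticAlgebra.norm_def, QuadraticAlgebra.re_sub, QuadraticAlgebra.im_sub,
      QuadraticAlgebra.re_star, QuadraticAlgebra.im_star]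
    linear_combination (-ϖ.im ^ 2) * h3
  rw [h2] at h1
  have h3 : ϖ.norm ∣ ϖ.im := h.dvd_of_dvd_pow h1
  have h4 : ϖ.norm ∣ ϖ.re := by
    refine h.dvd_of_dvd_pow (n := 2) ?_
    have h5 : ϖ.re ^ 2 = ϖ.norm - ϖ.im * (Zsqrtd.sqrtd * ϖ.re + ϖ.im) := by
      rw [QuadraticAlgebra.norm_def]; ring
    rw [h5]
    exact dvd_sub dvd_rfl (h3.mul_right _)
  have h5 : algebraMap R S ϖ.norm ∣ ϖ := QuadraticAlgebra.algebraMap_dvd_iff.2 ⟨h4, h3⟩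
  have h6 := norm_dvd h5
  rw [QuadraticAlgebra.norm_algebraMap, pow_two] at h6
  exact h.not_isUnit (isUnit_of_dvd_one
    ((mul_dvd_mul_iff_left h.ne_zero).1 (by rwa [mul_one])))

theorem fib_mul {ϖ : S} (h : Prime ϖ.norm) (ν : R) :
    fib (ϖ.norm * ν) = (ϖ * ·) '' fib ν ∪ (star ϖ * ·) '' fib ν := by
  have hP := prime_of_prime_norm h
  have hs : star ϖ ≠ 0 := by simpa using hP.ne_zero
  rw [mul_fib_eq hP.ne_zero, mul_fib_eq hs, QuadraticAlgebra.norm_star]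
  ext α
  constructor
  · intro hα
    have h1 : ϖ ∣ α * star α := by
      rw [← QuadraticAlgebra.algebraMap_norm_eq_mul_star, mem_fib.1 hα, map_mul,
        QuadraticAlgebra.algebraMap_norm_eq_mul_star, mul_assoc]
      exact dvd_mul_right _ _
    rcases hP.dvd_or_dvd h1 with h2 | h2
    · exact Or.inl ⟨hα, h2⟩
    · refine Or.inr ⟨hα, ?_⟩
      simpa using star_dvd_star h2
  · rintro (h | h) <;> exact h.1

theorem mem_inter_iff_dvd {ϖ : S} (h : Prime ϖ.norm) (ν : R) (α : S) :
    α ∈ (ϖ * ·) '' fib ν ∩ (star ϖ * ·) '' fib ν ↔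
      α ∈ fib (ϖ.norm * ν) ∧ algebraMap R S ϖ.norm ∣ α := by
  have hP := prime_of_prime_norm h
  have hs : star ϖ ≠ 0 := by simpa using hP.ne_zero
  rw [mul_fib_eq hP.ne_zero, mul_fib_eq hs, QuadraticAlgebra.norm_star,
    QuadraticAlgebra.algebraMap_norm_eq_mul_star]
  constructor
  · rintro ⟨⟨hα, h1⟩, -, γ, rfl⟩
    obtain ⟨δ, rfl⟩ := (hP.dvd_or_dvd h1).resolve_left (not_dvd_star h)
    exact ⟨hα, δ, by ring⟩
  · rintro ⟨hα, hd⟩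
    exact ⟨⟨hα, (dvd_mul_right _ _).trans hd⟩, hα, (dvd_mul_left _ _).trans hd⟩

theorem ncard_fib_union {ϖ : S} (h : Prime ϖ.norm) (ν : R) :
    (fib (ϖ.norm * ν)).ncard + {α ∈ fib (ϖ.norm * ν) | algebraMap R S ϖ.norm ∣ α}.ncard =
      2 * (fib ν).ncard := by
  have hP := prime_of_prime_norm h
  have hs : star ϖ ≠ 0 := by simpa using hP.ne_zero
  have h1 := Set.ncard_union_add_ncard_inter ((ϖ * ·) '' fib ν) ((star ϖ * ·) '' fib ν)
    ((finite_fib ν).image _) ((finite_fib ν).image _)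
  rw [← fib_mul h, ncard_mul_image hP.ne_zero, ncard_mul_image hs] at h1
  rw [two_mul, ← h1]
  congr 2
  ext α
  exact (mem_inter_iff_dvd h ν α).symm

theorem ncard_fib_split_of_not_dvd {ϖ : S} (h : Prime ϖ.norm) {ν : R} (hν : ¬ ϖ.norm ∣ ν) :
    (fib (ϖ.norm * ν)).ncard = 2 * (fib ν).ncard := by
  have : {α ∈ fib (ϖ.norm * ν) | algebraMap R S ϖ.norm ∣ α} = ∅ := by
    rw [Set.eq_empty_iff_forall_notMem]
    rintro _ ⟨hα, β, rfl⟩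
    rw [mem_fib, map_mul, QuadraticAlgebra.norm_algebraMap, pow_two, mul_assoc] at hα
    exact hν ⟨_, (mul_left_cancel₀ h.ne_zero hα).symm⟩
  have h1 := ncard_fib_union h ν
  rwa [this, Set.ncard_empty, add_zero] at h1

theorem ncard_fib_split_mul {ϖ : S} (h : Prime ϖ.norm) (ν : R) :
    (fib (ϖ.norm * (ϖ.norm * ν))).ncard + (fib ν).ncard = 2 * (fib (ϖ.norm * ν)).ncard := by
  have h1 := ncard_fib_union h (ϖ.norm * ν)
  have h2 := mul_fib_eq (algebraMap_ne_zero h.ne_zero) ν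
  rw [QuadraticAlgebra.norm_algebraMap, pow_two, mul_assoc] at h2
  rwa [← h2, ncard_mul_image (algebraMap_ne_zero h.ne_zero)] at h1

theorem ncard_fib_norm_of_isUnit {β : S} (hβ : IsUnit β) (ν : R) :
    (fib (β.norm * ν)).ncard = (fib ν).ncard := by
  rw [← ncard_mul_image hβ.ne_zero (fib ν), mul_fib_eq hβ.ne_zero]
  congr 1
  ext α
  exact ⟨fun h => ⟨h, hβ.dvd⟩, fun h => h.1⟩

theorem intCast_dvd_of_zmod_eq_zero {q : ℕ} {n : ℤ} (h : (n : ZMod q) = 0) :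
    ((q : ℕ) : R) ∣ (n : R) := by
  obtain ⟨k, hk⟩ := (ZMod.intCast_zmod_eq_zero_iff_dvd n q).1 h
  exact ⟨k, by rw [hk]; push_cast; rfl⟩

/-- A prime of `ℤ[√3]` divides a rational prime. -/
theorem exists_prime_dvd {p : R} (hp : Prime p) : ∃ q : ℕ, q.Prime ∧ p ∣ (q : R) := by
  have h1 : p ∣ ((p.norm.natAbs : ℕ) : R) := by
    have h2 : p ∣ ((p.norm : ℤ) : R) := by rw [Zsqrtd.norm_eq_mul_conj]; exact dvd_mul_right _ _
    rw [← Int.cast_natCast]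
    rcases Int.natAbs_eq p.norm with h | h
    · rwa [h] at h2
    · rwa [h, Int.cast_neg, dvd_neg] at h2
  have h0 : p.norm.natAbs ≠ 0 := by
    rw [Int.natAbs_ne_zero, Ne, norm_eq_zero_iff]; exact hp.ne_zero
  generalize p.norm.natAbs = n at h0 h1
  induction n using Nat.recOnMul with
  | zero => exact absurd rfl h0
  | one => exact absurd (isUnit_of_dvd_one (by simpa using h1)) hp.not_isUnit
  | prime q hq => exact ⟨q, hq, h1⟩
  | mul a b ha hb =>
    rw [Nat.cast_mul] at h1
    rcases hp.dvd_or_dvd h1 with h | h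
    · exact ha (left_ne_zero_of_mul h0) h
    · exact hb (right_ne_zero_of_mul h0) h

theorem exists_dvd_sq_add_one_of_inert {q : ℕ} (hq : q.Prime) (hqp : Prime (q : R))
    (h3 : q % 4 = 3) : ∃ x : R, (q : R) ∣ x ^ 2 + 1 := by
  have : Fact q.Prime := ⟨hq⟩
  have hsq : (Zsqrtd.sqrtd : R) * Zsqrtd.sqrtd = 3 := by decide
  have hcoord : ∀ a b : ℤ, (q : R) ∣ ⟨a, b⟩ → (q : ℤ) ∣ a ∧ (q : ℤ) ∣ b := fun a b h => by
    have := (Zsqrtd.intCast_dvd (d := 3) q ⟨a, b⟩).1 (by exact_mod_cast h)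
    exact this
  have hne1 : ¬ (q : ℤ) ∣ 1 := fun h => hq.one_lt.ne' (by
    have := Int.natCast_dvd_natCast.1 (by exact_mod_cast h : (q : ℤ) ∣ ((1 : ℕ) : ℤ))
    exact Nat.dvd_one.1 this)
  have hns : ¬ IsSquare ((3 : ℤ) : ZMod q) := by
    rintro ⟨y, hy⟩
    obtain ⟨t, rfl⟩ := ZMod.intCast_surjective y
    have h1 : (q : R) ∣ (((3 - t * t : ℤ)) : R) :=
      intCast_dvd_of_zmod_eq_zero (by push_cast; push_cast at hy; rw [hy]; ring)
    have h2 : (((3 - t * t : ℤ)) : R) =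
        ((Zsqrtd.sqrtd : R) - ((t : ℤ) : R)) * ((Zsqrtd.sqrtd : R) + ((t : ℤ) : R)) := by
      push_cast; linear_combination -hsq
    rw [h2] at h1
    rcases hqp.dvd_or_dvd h1 with h | h
    · have h' := hcoord (-t) 1 (by convert h using 1; ext <;> simp)
      exact hne1 h'.2
    · have h' := hcoord t 1 (by convert h using 1; ext <;> simp)
      exact hne1 h'.2
  have hns' : ¬ IsSquare ((-1 : ℤ) : ZMod q) := by
    push_cast
    rw [ZMod.exists_sq_eq_neg_one_iff]
    omega
  have h30 : ((3 : ℤ) : ZMod q) ≠ 0 := fun h => hns (h ▸ IsSquare.zero)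
  have h10 : ((-1 : ℤ) : ZMod q) ≠ 0 := fun h => hns' (h ▸ IsSquare.zero)
  have hl : legendreSym q (3 * -1) = 1 := by
    rw [legendreSym.mul, (legendreSym.eq_neg_one_iff q).2 hns,
      (legendreSym.eq_neg_one_iff q).2 hns']
    norm_num
  obtain ⟨y, hy⟩ := (legendreSym.eq_one_iff q (by push_cast at *; simpa using h30)).1 hl
  obtain ⟨s, hs⟩ := ZMod.intCast_surjective (y * ((3 : ℤ) : ZMod q)⁻¹)
  refine ⟨((s : ℤ) : R) * (Zsqrtd.sqrtd : R), ?_⟩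
  have h4 : (((s : ℤ) : R) * (Zsqrtd.sqrtd : R)) ^ 2 + 1 = ((3 * s ^ 2 + 1 : ℤ) : R) := by
    push_cast; linear_combination (s : R) ^ 2 * hsq
  rw [h4]
  refine intCast_dvd_of_zmod_eq_zero ?_
  push_cast at *
  rw [hs]
  field_simp
  linear_combination -hy

theorem exists_dvd_sq_add_one {p : R} (hp : Prime p) (hpos : 0 < p.norm) (hodd : ¬ pi2 ∣ p) :
    ∃ x : R, p ∣ x ^ 2 + 1 := by
  obtain ⟨q, hq, s, hs⟩ := exists_prime_dvd hp
  have : Fact q.Prime := ⟨hq⟩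
  by_cases hq4 : q % 4 = 3
  · have hN := congrArg Zsqrtd.norm hs
    rw [Zsqrtd.norm_natCast, Zsqrtd.norm_mul] at hN
    have hq0 : (0 : ℤ) < q := by exact_mod_cast hq.pos
    have hdvd : p.norm.natAbs ∣ q ^ 2 := by
      refine ⟨s.norm.natAbs, ?_⟩
      rw [← Int.natAbs_mul, ← hN, pow_two]
      rfl
    have hmod : p.norm % 4 = 1 := by
      have h0 : ∀ a : ℤ, a % 2 = 0 → a * a % 4 = 0 := fun a h => by
        obtain ⟨k, rfl⟩ := Int.dvd_of_emod_eq_zero h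
        rw [mul_mul_mul_comm]
        exact Int.mul_emod_right _ _
      have h1 : ∀ a : ℤ, a % 2 = 1 → a * a % 4 = 1 := fun a h => by
        rw [Int.mul_emod]
        rcases (by omega : a % 4 = 1 ∨ a % 4 = 3) with h | h <;> rw [h] <;> norm_num
      rw [pi2_dvd_iff] at hodd
      rw [Zsqrtd.norm_def, mul_assoc]
      rcases Int.emod_two_eq_zero_or_one p.re with h | h
      · have h2 := h0 _ h
        have h3 := h1 p.im (by omega)
        omega
      · have h2 := h1 _ h
        have h3 := h0 p.im (by omega)
        omega
    obtain ⟨i, hi, hpi⟩ := (Nat.dvd_prime_pow hq).1 hdvd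
    interval_cases i
    · exact absurd (Zsqrtd.norm_eq_one_iff.1 (by simpa using hpi)) hp.not_isUnit
    · rw [pow_one] at hpi; omega
    · have hp2 : p.norm = q * q := by
        have : (p.norm.natAbs : ℤ) = q * q := by rw [hpi]; push_cast; ring
        omega
      have hs1 : s.norm = 1 := by
        rw [hp2] at hN
        exact (mul_right_eq_self₀.1 hN.symm).resolve_right (by positivity)
      have hu := (isUnit_iff_norm s).2 hs1
      have hassoc : Associated p (q : R) := ⟨hu.unit, by rw [hs]; rfl⟩
      obtain ⟨x, hx⟩ := exists_dvd_sq_add_one_of_inert hq (hassoc.prime hp) hq4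
      exact ⟨x, hassoc.dvd.trans hx⟩
  · obtain ⟨y, hy⟩ := (ZMod.exists_sq_eq_neg_one_iff (p := q)).2 hq4
    obtain ⟨t, rfl⟩ := ZMod.intCast_surjective y
    refine ⟨t, (Dvd.intro s hs.symm).trans ?_⟩
    have := intCast_dvd_of_zmod_eq_zero (q := q) (n := t ^ 2 + 1)
      (by push_cast; linear_combination -hy)
    exact_mod_cast this

theorem exists_norm_associated {p : R} (hp : Prime p) (hpos : 0 < p.norm) (hodd : ¬ pi2 ∣ p) :
    ∃ ϖ : S, Associated ϖ.norm p := by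
  refine (prime_or_exists_norm hp).resolve_left fun hP => ?_
  obtain ⟨x, hx⟩ := exists_dvd_sq_add_one hp hpos hodd
  have h1 : algebraMap R S (x ^ 2 + 1) = ⟨x - Zsqrtd.sqrtd, 2⟩ * ⟨x + Zsqrtd.sqrtd, -2⟩ := by
    have h3 : (Zsqrtd.sqrtd : R) * Zsqrtd.sqrtd = 3 := by decide
    ext1
    · simp only [QuadraticAlgebra.algebraMap_re, QuadraticAlgebra.re_mul]
      linear_combination h3
    · simp only [QuadraticAlgebra.algebraMap_im, QuadraticAlgebra.im_mul]
      ring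
  have h2 : p ∣ 2 := by
    have h := map_dvd (algebraMap R S) hx
    rw [h1] at h
    rcases hP.dvd_or_dvd h with h | h
    · exact (QuadraticAlgebra.algebraMap_dvd_iff.1 h).2
    · exact (dvd_neg.1 (QuadraticAlgebra.algebraMap_dvd_iff.1 h).2)
  have h3 : p ∣ pi2 ^ 2 := h2.trans ⟨⟨2, 1⟩, by decide⟩
  have h4 := (hp.irreducible.associated_of_dvd prime_pi2.irreducible (hp.dvd_of_dvd_pow h3))
  exact hodd h4.dvd'

theorem exists_norm_eq_of_re_norm (n : ℕ) : ∀ u : R, u.im.natAbs = n → 0 < u.re → u.norm = 1 →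
    ∃ β : S, β.norm = u := by
  induction n using Nat.strong_induction_on with
  | _ n ih =>
    intro u hn hre hN
    rw [Zsqrtd.norm_def] at hN
    rcases lt_trichotomy u.im 0 with h | h | h
    · obtain ⟨β, hβ⟩ := ih (2 * u.im + u.re).natAbs
        (by
          have h1 : u.re < -3 * u.im := by nlinarith
          have h2 : -u.im < u.re := by nlinarith
          omega)
        (u * ⟨2, 1⟩) (by simp [Zsqrtd.im_mul]; ring_nf) (by simp [Zsqrtd.re_mul]; nlinarith)
        (by rw [Zsqrtd.norm_mul, Zsqrtd.norm_def, hN]; norm_num [Zsqrtd.norm_def])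
      refine ⟨β * ⟨1, ⟨1, -1⟩⟩, ?_⟩
      rw [map_mul, hβ, mul_assoc,
        show (⟨2, 1⟩ * QuadraticAlgebra.norm (⟨1, ⟨1, -1⟩⟩ : S) : R) = 1 by decide, mul_one]
    · refine ⟨1, ?_⟩
      rw [QuadraticAlgebra.norm_one]
      have : u.re = 1 := by rw [h] at hN; nlinarith
      ext <;> simp [h, this]
    · obtain ⟨β, hβ⟩ := ih (2 * u.im - u.re).natAbs
        (by
          have h1 : u.re < 3 * u.im := by nlinarith
          have h2 : u.im < u.re := by nlinarith
          omega)
        (u * ⟨2, -1⟩) (by simp [Zsqrtd.im_mul]; ring_nf) (by simp [Zsqrtd.re_mul]; nlinarith)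
        (by rw [Zsqrtd.norm_mul, Zsqrtd.norm_def, hN]; norm_num [Zsqrtd.norm_def])
      refine ⟨β * ⟨1, ⟨-1, -1⟩⟩, ?_⟩
      rw [map_mul, hβ, mul_assoc,
        show (⟨2, -1⟩ * QuadraticAlgebra.norm (⟨1, ⟨-1, -1⟩⟩ : S) : R) = 1 by decide, mul_one]

theorem natAbs_norm_lt {p a : R} (hp : Prime p) (ha : a ≠ 0) :
    a.norm.natAbs < (p * a).norm.natAbs := by
  have h1 : p.norm.natAbs ≠ 0 := by
    rw [Int.natAbs_ne_zero, Ne, norm_eq_zero_iff]; exact hp.ne_zero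
  have h2 : p.norm.natAbs ≠ 1 := fun h => hp.not_isUnit (Zsqrtd.norm_eq_one_iff.1 h)
  have h3 : a.norm.natAbs ≠ 0 := by
    rw [Int.natAbs_ne_zero, Ne, norm_eq_zero_iff]; exact ha
  rw [Zsqrtd.norm_mul, Int.natAbs_mul]
  exact lt_mul_of_one_lt_left (by omega) (by omega)

theorem chiIdeal_span_of_pos {p : R} (hodd : ¬ pi2 ∣ p) (h : 0 < p.norm) :
    chiIdeal (Ideal.span {p}) = 1 := by
  rw [chiIdeal_span, if_neg hodd, Int.sign_eq_one_of_pos h]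

theorem chiIdeal_span_of_neg {p : R} (hodd : ¬ pi2 ∣ p) (h : p.norm < 0) :
    chiIdeal (Ideal.span {p}) = -1 := by
  rw [chiIdeal_span, if_neg hodd, Int.sign_eq_neg_one_of_neg h]

theorem norm_pi2 : pi2.norm = -2 := by decide

theorem ncard_fib_of_isUnit {u : R} (hu : IsUnit u) (hpos : TotPos u) : (fib u).ncard = 12 := by
  obtain ⟨β, hβ⟩ := exists_norm_eq_of_re_norm _ u rfl hpos.re_pos ((isUnit_iff_norm u).1 hu)
  have h : IsUnit β := QuadraticAlgebra.isUnit_iff_norm_isUnit.2 (hβ ▸ hu)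
  rw [← mul_one u, ← hβ, ncard_fib_norm_of_isUnit h, ncard_fib_one]

/-- The number of elements of `ℤ[ζ₁₂]` of given totally positive relative norm. -/
theorem ncard_fib_eq (n : ℕ) : ∀ ν : R, ν.norm.natAbs = n → TotPos ν →
    ((fib ν).ncard : ℤ) = 12 * sigmaChi ν := by
  induction n using Nat.strong_induction_on with
  | _ n ih =>
  rintro ν rfl hν
  replace ih : ∀ μ : R, μ.norm.natAbs < ν.norm.natAbs → TotPos μ →
    ((fib μ).ncard : ℤ) = 12 * sigmaChi μ := fun μ h => ih _ h μ rfl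
  by_cases hu : IsUnit ν
  · rw [ncard_fib_of_isUnit hu hν, sigmaChi_unit hu]
    norm_num
  by_cases hex : ∃ p : R, Prime p ∧ ¬ pi2 ∣ p ∧ p ∣ ν
  · obtain ⟨p, hp, hodd, hdvd⟩ := hex
    have hp0 : p.norm ≠ 0 := by rw [Ne, norm_eq_zero_iff]; exact hp.ne_zero
    rcases lt_or_gt_of_ne hp0 with hneg | hpos
    · have hχ := chiIdeal_span_of_neg hodd hneg
      obtain ⟨μ, rfl⟩ := hdvd
      have hμ0 := right_ne_zero_of_mul hν.ne_zero
      by_cases hpμ : p ∣ μ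
      · obtain ⟨ξ, rfl⟩ := hpμ
        have hξ0 := right_ne_zero_of_mul hμ0
        have hξ : TotPos ξ := by
          rw [← mul_assoc] at hν
          exact hν.of_mul (TotPos.mul_self hp.ne_zero)
        rw [ncard_fib_mul_mul hp hneg, sigmaChi_mul_mul hp hξ0, hχ,
          ih ξ ((natAbs_norm_lt hp hξ0).trans (natAbs_norm_lt hp hμ0)) hξ]
        ring
      · rw [fib_of_not_dvd hp hneg hpμ, sigmaChi_mul_of_not_dvd hp hμ0 hpμ, hχ]
        simp
    · obtain ⟨ϖ, hϖ⟩ := exists_norm_associated hp hpos hodd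
      have hq : Prime ϖ.norm := hϖ.symm.prime hp
      have hqpos : TotPos ϖ.norm := totPos_norm fun h => hq.ne_zero (by simp [h])
      have hχ := chiIdeal_span_of_pos (fun h => hodd (h.trans hϖ.dvd)) hqpos.norm_pos
      obtain ⟨μ, rfl⟩ := hϖ.dvd.trans hdvd
      have hμ := hν.of_mul hqpos
      have h1 := ih μ (natAbs_norm_lt hq hμ.ne_zero) hμ
      by_cases hqμ : ϖ.norm ∣ μ
      · obtain ⟨ξ, rfl⟩ := hqμ
        have hξ := hμ.of_mul hqpos
        have h2 := ih ξ ((natAbs_norm_lt hq hξ.ne_zero).trans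
          (natAbs_norm_lt hq hμ.ne_zero)) hξ
        have h3 := ncard_fib_split_mul hq ξ
        rw [sigmaChi_mul_mul hq hξ.ne_zero, hχ]
        zify at h3
        linear_combination h3 + 2 * h1 - h2
      · rw [ncard_fib_split_of_not_dvd hq hqμ, sigmaChi_mul_of_not_dvd hq hμ.ne_zero hqμ, hχ]
        push_cast
        linear_combination 2 * h1
  · have hall : ∀ μ : R, μ ∣ ν → μ ≠ 0 → ¬ IsUnit μ → pi2 ∣ μ := fun μ hμ h0 hu => by
      obtain ⟨p, hp, hpμ⟩ := WfDvdMonoid.exists_irreducible_factor hu h0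
      by_contra hcon
      exact hex ⟨p, hp.prime, fun h => hcon (h.trans hpμ), hpμ.trans hμ⟩
    obtain ⟨μ, rfl⟩ := hall ν dvd_rfl hν.ne_zero hu
    have hμ0 := right_ne_zero_of_mul hν.ne_zero
    by_cases huμ : IsUnit μ
    · have := hν.norm_pos
      rw [Zsqrtd.norm_mul, (isUnit_iff_norm μ).1 huμ, norm_pi2] at this
      norm_num at this
    · obtain ⟨ξ, rfl⟩ := hall μ (dvd_mul_left _ _) hμ0 huμ
      have hξ0 := right_ne_zero_of_mul hμ0
      have hξ : TotPos ξ := by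
        rw [← mul_assoc] at hν
        exact hν.of_mul (TotPos.mul_self prime_pi2.ne_zero)
      rw [ncard_fib_mul_mul prime_pi2 (by decide), sigmaChi_pi2_mul hμ0, sigmaChi_pi2_mul hξ0,
        ih ξ ((natAbs_norm_lt prime_pi2 hξ0).trans (natAbs_norm_lt prime_pi2 hμ0)) hξ]

theorem r2_eq_ncard (ν : R) : r2 ν = {α ∈ fib ν | 2 ∣ α.im}.ncard := by
  have h3 : (Zsqrtd.sqrtd : R) * Zsqrtd.sqrtd = 3 := by decide
  have hinj : Function.Injective
      fun t : R × R => (⟨t.1 - Zsqrtd.sqrtd * t.2, 2 * t.2⟩ : S) := by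
    rintro ⟨a, b⟩ ⟨c, d⟩ h
    simp only [QuadraticAlgebra.mk.injEq] at h
    have h2 : b = d := mul_left_cancel₀ two_ne_zero h.2
    subst h2
    simpa using h.1
  rw [r2, ← Set.ncard_image_of_injective _ hinj]
  congr 1
  ext ⟨x, y⟩
  simp only [Set.mem_image, Set.mem_ofPred_eq, Prod.exists, QuadraticAlgebra.mk.injEq, mem_fib,
    QuadraticAlgebra.norm_def]
  constructor
  · rintro ⟨a, b, h, rfl, rfl⟩
    refine ⟨?_, dvd_mul_right _ _⟩
    linear_combination h - b ^ 2 * h3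
  · rintro ⟨h, b, rfl⟩
    refine ⟨x + Zsqrtd.sqrtd * b, b, ?_, by ring, rfl⟩
    linear_combination h + b ^ 2 * h3

/-- A primitive cube root of unity in `ℤ[ζ₁₂]`. -/
def cubeRoot : S := ⟨-2, Zsqrtd.sqrtd⟩

theorem norm_cubeRoot : cubeRoot.norm = 1 := by decide

theorem cubeRoot_mul (α : S) : cubeRoot * α =
    ⟨-2 * α.re - Zsqrtd.sqrtd * α.im, Zsqrtd.sqrtd * α.re + α.im⟩ := by
  have h3 : (Zsqrtd.sqrtd : R) * Zsqrtd.sqrtd = 3 := by decide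
  ext1
  · simp only [cubeRoot, QuadraticAlgebra.re_mul]
    ring
  · simp only [cubeRoot, QuadraticAlgebra.im_mul]
    linear_combination α.im * h3

theorem ncard_cubeRoot_mul (ν : R) (P : S → Prop) :
    {α ∈ fib ν | P (cubeRoot * α)}.ncard = {α ∈ fib ν | P α}.ncard := by
  have h0 : cubeRoot ≠ 0 := by decide
  have hu : IsUnit cubeRoot := QuadraticAlgebra.isUnit_iff_norm_isUnit.2 (by simp [norm_cubeRoot])
  rw [← ncard_mul_image h0]
  congr 1
  ext α
  constructor
  · rintro ⟨β, ⟨hβ, hP⟩, rfl⟩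
    exact ⟨by rw [mem_fib, map_mul, norm_cubeRoot, one_mul]; exact hβ, hP⟩
  · rintro ⟨hα, hP⟩
    obtain ⟨β, rfl⟩ := hu.dvd (a := α)
    exact ⟨β, ⟨by rwa [mem_fib, map_mul, norm_cubeRoot, one_mul] at hα, hP⟩, rfl⟩

theorem two_dvd_sqrtd_mul (a : R) : 2 ∣ Zsqrtd.sqrtd * a ↔ 2 ∣ a := by
  rw [two_dvd_iff, two_dvd_iff]
  simp only [Zsqrtd.re_mul, Zsqrtd.im_mul, Zsqrtd.re_sqrtd, Zsqrtd.im_sqrtd]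
  omega

/-- If every element of relative norm `ν` lies in exactly one of three classes permuted by
a cube root of unity, one third of them come from sums of two squares. -/
theorem three_mul_r2 {ν : R}
    (h1 : ∀ α ∈ fib ν, 2 ∣ α.im ∨ 2 ∣ Zsqrtd.sqrtd * α.re + α.im ∨ 2 ∣ α.re)
    (h2 : ∀ α ∈ fib ν, ¬ (2 ∣ α.im ∧ 2 ∣ α.re)) :
    3 * r2 ν = (fib ν).ncard := by
  set A : Set S := {α ∈ fib ν | 2 ∣ α.im} with hA
  set B : Set S := {α ∈ fib ν | 2 ∣ Zsqrtd.sqrtd * α.re + α.im} with hB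
  set C : Set S := {α ∈ fib ν | 2 ∣ α.re} with hC
  have hAB : B.ncard = A.ncard := by
    have h := ncard_cubeRoot_mul ν fun α => 2 ∣ α.im
    simpa only [cubeRoot_mul] using h
  have hBC : C.ncard = B.ncard := by
    refine Eq.trans ?_ (ncard_cubeRoot_mul ν fun α => 2 ∣ Zsqrtd.sqrtd * α.re + α.im)
    congr 1
    ext α
    refine and_congr_right fun _ => ?_
    have h3 : (Zsqrtd.sqrtd : R) * Zsqrtd.sqrtd = 3 := by decide
    rw [cubeRoot_mul, ← two_dvd_sqrtd_mul α.re, ← dvd_neg,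
      ← dvd_add_left (dvd_mul_right (2 : R) (-α.im))]
    congr! 1
    linear_combination α.im * h3
  have hfin := finite_fib ν
  have hun : fib ν = A ∪ (B ∪ C) := by
    ext α
    exact ⟨fun h => (h1 α h).imp (⟨h, ·⟩) (Or.imp (⟨h, ·⟩) (⟨h, ·⟩)), fun h => by
      rcases h with h | h | h <;> exact h.1⟩
  have hdBC : Disjoint B C := Set.disjoint_left.2 fun α hb hc =>
    h2 α hc.1 ⟨(dvd_add_right (hc.2.mul_left _)).1 hb.2, hc.2⟩
  have hdA : Disjoint A (B ∪ C) := Set.disjoint_left.2 fun α ha hbc => h2 α ha.1 ⟨ha.2, by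
    rcases hbc with hb | hc
    · exact (two_dvd_sqrtd_mul _).1 ((dvd_add_left ha.2).1 hb.2)
    · exact hc.2⟩
  have hfB : B.Finite := hfin.subset fun _ h => h.1
  have hfC : C.Finite := hfin.subset fun _ h => h.1
  rw [r2_eq_ncard, ← hA, hun, Set.ncard_union_eq hdA (hfin.subset fun _ h => h.1)
    (hfB.union hfC), Set.ncard_union_eq hdBC hfB hfC]
  omega

theorem zmod_two_eq_zero_iff (a : ℤ) : (a : ZMod 2) = 0 ↔ a % 2 = 0 := by
  rw [ZMod.intCast_zmod_eq_zero_iff_dvd]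
  omega

theorem three_mul_r2_of_not_dvd {ν : R} (hν : ¬ pi2 ∣ ν) (him : Even ν.im) :
    3 * r2 ν = (fib ν).ncard := by
  set_option synthInstance.maxSize 1000 in
  set_option synthInstance.maxHeartbeats 200000 in
  have key : ∀ a b c d : ZMod 2,
      ¬ (a ^ 2 + 3 * a * d + 3 * d ^ 2 + (c ^ 2 + 3 * c * b + 3 * b ^ 2) = 0) →
      2 * a * b + 2 * c * d + a * c + 3 * b * d = 0 →
      ((c = 0 ∧ d = 0) ∨ (3 * b + c = 0 ∧ a + d = 0) ∨ (a = 0 ∧ b = 0)) ∧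
      ¬ ((c = 0 ∧ d = 0) ∧ (a = 0 ∧ b = 0)) := by
    decide
  have h : ∀ α ∈ fib ν, (2 ∣ α.im ∨ 2 ∣ Zsqrtd.sqrtd * α.re + α.im ∨ 2 ∣ α.re) ∧
      ¬ (2 ∣ α.im ∧ 2 ∣ α.re) := by
    rintro α rfl
    rw [Int.even_iff] at him
    have hre : ¬ α.norm.re % 2 = 0 := by
      rw [pi2_dvd_iff] at hν
      omega
    rw [← zmod_two_eq_zero_iff, norm_re] at hre
    rw [← zmod_two_eq_zero_iff, norm_im] at him
    have := key α.re.re α.re.im α.im.re α.im.im (by push_cast at hre; exact hre)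
      (by push_cast at him; exact him)
    simp only [two_dvd_iff, ← zmod_two_eq_zero_iff, Zsqrtd.re_add, Zsqrtd.im_add, Zsqrtd.re_mul,
      Zsqrtd.im_mul, Zsqrtd.re_sqrtd, Zsqrtd.im_sqrtd]
    push_cast
    simpa only [zero_mul, zero_add, mul_one, one_mul, add_zero] using this
  exact three_mul_r2 (fun α hα => (h α hα).1) (fun α hα => (h α hα).2)

theorem r2_of_odd {ν : R} (him : ¬ Even ν.im) : r2 ν = 0 := by
  have : {t : R × R | t.1 ^ 2 + t.2 ^ 2 = ν} = ∅ := by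
    rw [Set.eq_empty_iff_forall_notMem]
    rintro ⟨a, b⟩ rfl
    refine him ⟨a.re * a.im + b.re * b.im, ?_⟩
    simp [pow_two]
    ring
  rw [r2, this, Set.ncard_empty]

theorem two_eq_pi2_mul : (2 : R) = pi2 * (pi2 * ⟨2, -1⟩) := by decide

theorem exists_of_mem_fib_two_mul {μ : R} {α : S} (h : α ∈ fib (2 * μ)) :
    ∃ β ∈ fib (⟨2, -1⟩ * μ), α = algebraMap R S pi2 * β := by
  rw [two_eq_pi2_mul, mul_assoc, mul_assoc, fib_mul_mul prime_pi2 (by decide)] at h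
  obtain ⟨β, hβ, rfl⟩ := h
  exact ⟨β, hβ, rfl⟩

theorem isUnit_eps : IsUnit (⟨2, -1⟩ : R) := (isUnit_iff_norm _).2 (by decide)

theorem sigmaChi_two_mul {μ : R} (hμ : μ ≠ 0) : sigmaChi (2 * μ) = sigmaChi μ := by
  have h0 : (⟨2, -1⟩ * μ : R) ≠ 0 := mul_ne_zero isUnit_eps.ne_zero hμ
  rw [two_eq_pi2_mul, mul_assoc, mul_assoc, sigmaChi_pi2_mul (mul_ne_zero prime_pi2.ne_zero h0),
    sigmaChi_pi2_mul h0, sigmaChi, sigmaChi, Ideal.span_singleton_mul_left_unit isUnit_eps]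

theorem three_mul_r2_two_mul {μ : R} (hμ : ¬ pi2 ∣ μ) : 3 * r2 (2 * μ) = (fib (2 * μ)).ncard := by
  have key : ∀ a b c d : ZMod 2,
      ¬ ((a ^ 2 + 3 * a * d + 3 * d ^ 2 + (c ^ 2 + 3 * c * b + 3 * b ^ 2)) +
        (2 * a * b + 2 * c * d + a * c + 3 * b * d) = 0) →
      ((c + d = 0) ∨ (a + b + (c + d) = 0) ∨ (a + b = 0)) ∧ ¬ (c + d = 0 ∧ a + b = 0) := by
    decide
  have hdvd : ∀ a : R, 2 ∣ pi2 * a ↔ ((a.re : ℤ) : ZMod 2) + (a.im : ZMod 2) = 0 := fun a => by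
    rw [two_dvd_iff, ← Int.cast_add, zmod_two_eq_zero_iff]
    simp only [pi2, Zsqrtd.re_mul, Zsqrtd.im_mul]
    omega
  have h : ∀ α ∈ fib (2 * μ), (2 ∣ α.im ∨ 2 ∣ Zsqrtd.sqrtd * α.re + α.im ∨ 2 ∣ α.re) ∧
      ¬ (2 ∣ α.im ∧ 2 ∣ α.re) := by
    intro α hα
    obtain ⟨β, hβ, rfl⟩ := exists_of_mem_fib_two_mul hα
    have hodd : ¬ pi2 ∣ β.norm := by
      rw [mem_fib.1 hβ, isUnit_eps.dvd_mul_left]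
      exact hμ
    rw [pi2_dvd_iff, ← zmod_two_eq_zero_iff, norm_re, norm_im] at hodd
    have := key β.re.re β.re.im β.im.re β.im.im (by push_cast at hodd; exact hodd)
    have e1 : (algebraMap R S pi2 * β).re = pi2 * β.re := by simp
    have e2 : (algebraMap R S pi2 * β).im = pi2 * β.im := by simp
    have h3 : (3 : ZMod 2) = 1 := by decide
    rw [e1, e2, mul_left_comm, ← mul_add, hdvd, hdvd, hdvd]
    simp only [Zsqrtd.re_add, Zsqrtd.im_add, Zsqrtd.re_mul, Zsqrtd.im_mul, Zsqrtd.re_sqrtd,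
      Zsqrtd.im_sqrtd]
    push_cast
    convert this using 4
    rw [h3]
    ring_nf
  exact three_mul_r2 (fun α hα => (h α hα).1) (fun α hα => (h α hα).2)

theorem r2_two_mul_of_dvd {μ : R} (hμ : pi2 ∣ μ) : r2 (2 * μ) = (fib (2 * μ)).ncard := by
  rw [r2_eq_ncard]
  congr 1
  refine Set.Subset.antisymm (fun α h => h.1) fun α hα => ⟨hα, ?_⟩
  obtain ⟨β, hβ, rfl⟩ := exists_of_mem_fib_two_mul hα
  obtain ⟨ξ, hξ⟩ := hμ.mul_left ⟨2, -1⟩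
  rw [hξ] at hβ
  obtain ⟨γ, rfl⟩ := algebraMap_dvd_of_mem_fib prime_pi2 (by decide) hβ
  refine ⟨⟨2, 1⟩ * γ.im, ?_⟩
  have h4 : pi2 * pi2 = 2 * ⟨2, 1⟩ := by decide
  have e : (algebraMap R S pi2 * (algebraMap R S pi2 * γ)).im = pi2 * (pi2 * γ.im) := by simp
  rw [e]
  linear_combination γ.im * h4

/-- For every totally positive ν ∈ O_K,
r_{2,K}(ν) = 2·(6·σ_{0,χ}(ν) + (ρ₂(ν) − 5)·σ^{𝟙}_{0,χ}(ν) − 4·σ^{𝟙}_{0,χ}(ν/2)),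
where the last term is 0 when 2 ∤ ν. -/
theorem two_squares_formula (ν : Zsqrtd 3) (hpos : TotPos ν) :
    (¬ (2 : Zsqrtd 3) ∣ ν →
      (r2 ν : ℤ) = 2 * (6 * sigmaChi ν + (rho2 ν - 5) * sigmaChi1 ν)) ∧
    (∀ μ : Zsqrtd 3, ν = 2 * μ →
      (r2 ν : ℤ) = 2 * (6 * sigmaChi ν + (rho2 ν - 5) * sigmaChi1 ν - 4 * sigmaChi1 μ)) := by
  have hfib := ncard_fib_eq _ ν rfl hpos
  constructor
  · intro h2
    by_cases hd : pi2 ∣ ν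
    · rw [sigmaChi1_of_dvd hd]
      obtain ⟨μ, rfl⟩ := hd
      have hμ : ¬ pi2 ∣ μ := by
        rintro ⟨ξ, rfl⟩
        refine h2 ⟨⟨2, 1⟩ * ξ, ?_⟩
        have h4 : pi2 * pi2 = 2 * ⟨2, 1⟩ := by decide
        linear_combination ξ * h4
      have he : fib (pi2 * μ) = ∅ := fib_of_not_dvd prime_pi2 (by decide) hμ
      have hr : r2 (pi2 * μ) = 0 := by
        rw [r2_eq_ncard, he]
        simp
      rw [he, Set.ncard_empty] at hfib
      rw [hr]
      linear_combination hfib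
    · rw [sigmaChi1_of_not_dvd hd, rho2, if_neg hd]
      by_cases him : Even ν.im
      · have h3 := three_mul_r2_of_not_dvd hd him
        rw [if_pos him]
        zify at h3
        linarith
      · rw [if_neg him, r2_of_odd him]
        push_cast
        ring
  · rintro μ rfl
    have hμ0 := right_ne_zero_of_mul hpos.ne_zero
    have hd : pi2 ∣ 2 * μ := (Dvd.intro _ two_eq_pi2_mul.symm).mul_right _
    rw [sigmaChi1_of_dvd hd]
    by_cases hμ : pi2 ∣ μ
    · rw [sigmaChi1_of_dvd hμ, r2_two_mul_of_dvd hμ]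
      linear_combination hfib
    · have h3 := three_mul_r2_two_mul hμ
      rw [sigmaChi1_of_not_dvd hμ, ← sigmaChi_two_mul hμ0]
      zify at h3
      linarith

end Paper3
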